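/- arXiv:2604.08311 — 2 statements merged into one kernel-verified Lean document; each statement's English description precedes it below -/
import Mathlib

section
/- Let n = 2m, N = 2^n − 1, and F(x) = x^{d_1} + x^{d_2} on F_{2^n} with d_1, d_2 ∈ {1, …, N−1}, wt_2(d_1) = wt_2(d_2) = 2, and gcd(d_1, d_2, N) > 1. If ℓ(n) > m and #S_F = 2^m, then d_2 − d_1 ≡ 0 (mod 2^m − 1). -/
open Finset

/-- The Walsh transform `W_{F_a}(ω) = Σ_v (−1)^{Tr(a·F(v)) + Tr(ω·v)}`. -/
noncomputable def walsh {K : Type*} [Field K] [Fintype K] [Algebra (ZMod 2) K]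
    (F : K → K) (a ω : K) : ℤ :=
  ∑ v : K, if Algebra.trace (ZMod 2) K (a * F v) + Algebra.trace (ZMod 2) K (ω * v) = 0
    then 1 else -1

/-- The component `F_a` is bent: all Walsh values are `±2^m`. -/
def IsBent {K : Type*} [Field K] [Fintype K] [Algebra (ZMod 2) K]
    (m : ℕ) (F : K → K) (a : K) : Prop :=
  ∀ ω : K, walsh F a ω = 2 ^ m ∨ walsh F a ω = -(2 ^ m)

/-- `wt₂(j)`: the binary digit sum of the representative of `j mod N` in `{0, …, N−1}`. -/
def wt2 (N : ℕ) (j : ℤ) : ℕ := (Nat.digits 2 (j % (N : ℤ)).toNat).sum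

/-- The `F₂`-span of the Frobenius orbit `{γ, γ², γ⁴, …}` of `γ`. -/
def frobSpan (K : Type*) [Field K] [Algebra (ZMod 2) K] (γ : K) : Submodule (ZMod 2) K :=
  Submodule.span (ZMod 2) (Set.range fun i : ℕ => γ ^ (2 ^ i))

section TraceSign

variable {K : Type*} [Field K] [Algebra (ZMod 2) K]

/-- The additive character `x ↦ (-1)^{Tr x}`. -/
noncomputable def traceSign (x : K) : ℤ :=
  if Algebra.trace (ZMod 2) K x = 0 then 1 else -1

lemma add_self_eq_zero_of_algebra_two (x : K) : x + x = 0 := by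
  rw [← two_smul (ZMod 2) x]
  exact zero_smul (ZMod 2) x

lemma traceSign_add (x y : K) : traceSign (x + y) = traceSign x * traceSign y := by
  unfold traceSign
  rw [map_add]
  generalize Algebra.trace (ZMod 2) K x = a
  generalize Algebra.trace (ZMod 2) K y = b
  revert a b
  decide

variable [Fintype K]

lemma walsh_eq_sum_traceSign (F : K → K) (a ω : K) :
    walsh F a ω = ∑ v : K, traceSign (a * F v + ω * v) := by
  simp only [walsh, traceSign, map_add]

lemma walsh_zero_right (F : K → K) (a : K) :
    walsh F a 0 = ∑ v : K, traceSign (a * F v) := by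
  simp [walsh_eq_sum_traceSign]

lemma add_sq_eq_sq_add_sq (x y : K) : (x + y) ^ 2 = x ^ 2 + y ^ 2 := by
  have h := map_add (FiniteField.frobeniusAlgEquivOfAlgebraic (ZMod 2) K) x y
  simpa only [FiniteField.coe_frobeniusAlgEquivOfAlgebraic, ZMod.card] using h

lemma traceSign_sq (x : K) : traceSign (x ^ 2) = traceSign x := by
  have h := Algebra.trace_eq_of_algEquiv (FiniteField.frobeniusAlgEquivOfAlgebraic (ZMod 2) K) x
  rw [FiniteField.coe_frobeniusAlgEquivOfAlgebraic] at h
  simp only [ZMod.card] at h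
  simp only [traceSign, h]

open Classical in
lemma sum_traceSign_mul (U : Submodule (ZMod 2) K) (y : K) :
    ∑ a : U, traceSign ((a : K) * y) =
      if ∀ a ∈ U, Algebra.trace (ZMod 2) K (a * y) = 0 then (Nat.card U : ℤ) else 0 := by
  split_ifs with h
  · rw [Finset.sum_congr rfl (g := fun _ => (1 : ℤ))
      (fun a _ => by simp [traceSign, h a a.2])]
    simp
  · push Not at h
    obtain ⟨b, hb, hby⟩ := h
    have hshift : ∑ a : U, traceSign ((a : K) * y) =
        ∑ a : U, traceSign (((a + ⟨b, hb⟩ : U) : K) * y) :=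
      (Equiv.sum_comp (Equiv.addRight (⟨b, hb⟩ : U)) fun a : U => traceSign ((a : K) * y)).symm
    have hneg : traceSign (b * y) = -1 := by simp [traceSign, hby]
    simp only [Submodule.coe_add, add_mul, traceSign_add, hneg, mul_neg, mul_one,
      Finset.sum_neg_distrib] at hshift
    linarith

open Classical in
lemma sum_walsh_submodule (F : K → K) (U : Submodule (ZMod 2) K) :
    ∑ a : U, walsh F (a : K) 0 =
      Nat.card U * #{v : K | ∀ a ∈ U, Algebra.trace (ZMod 2) K (a * F v) = 0} := by
  simp only [walsh_zero_right]
  rw [Finset.sum_comm]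
  simp only [sum_traceSign_mul]
  rw [← Finset.sum_filter, Finset.sum_const, nsmul_eq_mul, mul_comm]

lemma eq_zero_of_trace_mul_eq_zero (y : K)
    (h : ∀ a : K, Algebra.trace (ZMod 2) K (a * y) = 0) : y = 0 := by
  refine (traceForm_nondegenerate (ZMod 2) K).2 y fun a => ?_
  simpa [Algebra.traceForm_apply] using h a

open Classical in
lemma sum_walsh_univ (F : K → K) :
    ∑ a : K, walsh F a 0 = Fintype.card K * #{v : K | F v = 0} := by
  have h := sum_walsh_submodule F ⊤
  have hz : ∀ v, (∀ a ∈ (⊤ : Submodule (ZMod 2) K),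
      Algebra.trace (ZMod 2) K (a * F v) = 0) ↔ F v = 0 := fun v =>
    ⟨fun h => eq_zero_of_trace_mul_eq_zero _ fun a => h a trivial, fun h => by simp [h]⟩
  simp only [hz] at h
  rw [← Nat.card_eq_fintype_card, ← Nat.card_congr (Submodule.topEquiv (R := ZMod 2)).toEquiv,
    ← h]
  exact ((Submodule.topEquiv (R := ZMod 2) (M := K)).toEquiv.sum_comp
    fun a => walsh F a 0).symm

end TraceSign

section BentComponents

variable {K : Type*} [Field K] [Fintype K] [Algebra (ZMod 2) K] {m : ℕ} {F : K → K}

lemma walsh_zero_zero (F : K → K) : walsh F 0 0 = Fintype.card K := by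
  simp [walsh]

lemma not_isBent_zero (hm : 0 < m) (hcard : Fintype.card K = 2 ^ (2 * m)) :
    ¬ IsBent m F 0 := by
  intro h
  have h0 := h 0
  rw [walsh_zero_zero, hcard] at h0
  push_cast at h0
  have h1 : (1 : ℤ) < 2 ^ m := one_lt_pow₀ (by norm_num) hm.ne'
  rw [two_mul, pow_add] at h0
  rcases h0 with h0 | h0 <;> nlinarith

/-- A subspace all of whose nonzero elements give bent components has dimension at most `m`. -/
lemma finrank_le_of_forall_isBent (hm : 0 < m) (hcard : Fintype.card K = 2 ^ (2 * m))
    (U : Submodule (ZMod 2) K) (hU : ∀ a ∈ U, a ≠ 0 → IsBent m F a) :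
    Module.finrank (ZMod 2) U ≤ m := by
  classical
  by_contra! hlt
  obtain ⟨k, hk⟩ := Nat.exists_eq_add_of_lt hlt
  have hcardU : Fintype.card U = 2 ^ (m + k + 1) := by
    rw [Module.card_eq_pow_finrank (K := ZMod 2), ZMod.card, hk]
  have hsum := sum_walsh_submodule F U
  rw [Nat.card_eq_fintype_card, hcardU, ← Finset.add_sum_erase _ _ (Finset.mem_univ (0 : U)),
    Submodule.coe_zero, walsh_zero_zero, hcard] at hsum
  have hmod : ∀ a ∈ (Finset.univ : Finset U).erase 0,
      walsh F (a : K) 0 ≡ 2 ^ m [ZMOD 2 ^ (m + 1)] := by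
    intro a ha
    rcases hU a a.2 (by simpa using ha) 0 with h | h <;> rw [h]
    exact (Int.modEq_iff_dvd.mpr ⟨1, by ring⟩)
  have hrest : ∑ a ∈ (Finset.univ : Finset U).erase 0, walsh F (a : K) 0 ≡
      ∑ a ∈ (Finset.univ : Finset U).erase 0, 2 ^ m [ZMOD 2 ^ (m + 1)] := Int.ModEq.sum hmod
  rw [Finset.sum_const, Finset.card_erase_of_mem (Finset.mem_univ _), Finset.card_univ, hcardU,
    nsmul_eq_mul, Nat.cast_sub Nat.one_le_two_pow] at hrest
  obtain ⟨c, hc⟩ := hrest.symm.dvd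
  obtain ⟨j, rfl⟩ : ∃ j, m = j + 1 := ⟨m - 1, by omega⟩
  push_cast at hsum hc
  have hpos : (2 : ℤ) ^ (j + 1) ≠ 0 := by positivity
  generalize hx : (#{v : K | ∀ a ∈ U, Algebra.trace (ZMod 2) K (a * F v) = 0} : ℤ) = x at hsum
  have key : (2 : ℤ) ^ (j + 1) * (2 * (2 ^ j + 2 ^ (j + 1 + k) + c - 2 ^ k * x)) =
      2 ^ (j + 1) * 1 := by
    ring_nf at hsum hc ⊢
    linarith
  have := mul_left_cancel₀ hpos key
  omega

/-- If exactly `2 ^ m` components are not bent, they form a subspace. -/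
lemma add_not_isBent (hm : 0 < m) (hcard : Fintype.card K = 2 ^ (2 * m))
    (hS : Set.ncard {a : K | ¬ IsBent m F a} = 2 ^ m) {x y : K}
    (hx : ¬ IsBent m F x) (hy : ¬ IsBent m F y) : ¬ IsBent m F (x + y) := by
  classical
  intro hxy
  let P : Submodule (ZMod 2) K → Prop := fun W => x + y ∈ W ∧ ∀ a ∈ W, a ≠ 0 → IsBent m F a
  have hP : P (Submodule.span (ZMod 2) {x + y}) := by
    refine ⟨Submodule.mem_span_singleton_self _, fun a ha ha0 => ?_⟩
    obtain ⟨c, rfl⟩ := Submodule.mem_span_singleton.mp ha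
    rcases (by decide : ∀ c : ZMod 2, c = 0 ∨ c = 1) c with rfl | rfl
    · simp at ha0
    · simpa using hxy
  obtain ⟨W, -, hW⟩ := (Set.toFinite {W | P W}).exists_le_maximal hP
  obtain ⟨hxyW, hWbent⟩ := hW.prop
  have hrank := finrank_le_of_forall_isBent hm hcard W hWbent
  have hne : x ≠ y := by
    rintro rfl
    exact not_isBent_zero hm hcard (add_self_eq_zero_of_algebra_two x ▸ hxy)
  -- The quotient by `W` is not covered by the classes of the non-bent elements.
  let S : Set K := {a : K | ¬ IsBent m F a}
  obtain ⟨q, hq⟩ : ∃ q : K ⧸ W, q ∉ W.mkQ '' S := by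
    by_contra! hall
    have himage : W.mkQ '' S = W.mkQ '' (S \ {y}) := by
      refine Set.Subset.antisymm ?_ (Set.image_mono Set.sdiff_subset)
      rintro _ ⟨a, ha, rfl⟩
      by_cases hay : a = y
      · refine ⟨x, ⟨hx, hne⟩, ?_⟩
        subst hay
        rw [← sub_eq_zero, ← map_sub, Submodule.mkQ_apply, Submodule.Quotient.mk_eq_zero]
        have hneg : x - a = x + a := by
          rw [sub_eq_add_neg, add_right_inj, neg_eq_iff_add_eq_zero,
            add_self_eq_zero_of_algebra_two]
        rwa [hneg]
      · exact ⟨a, ⟨ha, hay⟩, rfl⟩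
    have huniv : W.mkQ '' (S \ {y}) = Set.univ := by
      rw [← himage]
      exact Set.eq_univ_of_forall hall
    have hle := Set.ncard_image_le (f := W.mkQ) (Set.toFinite (S \ {y}))
    rw [huniv, Set.ncard_univ, Set.ncard_sdiff_singleton_of_mem hy, hS] at hle
    have hprod : 2 ^ (2 * m) = Nat.card (K ⧸ W) * Nat.card W := by
      rw [mul_comm (Nat.card _), ← Submodule.card_eq_card_quotient_mul_card,
        Nat.card_eq_fintype_card, hcard]
    have hcardW : Nat.card W ≤ 2 ^ m := by
      rw [Nat.card_eq_fintype_card, Module.card_eq_pow_finrank (K := ZMod 2), ZMod.card]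
      exact Nat.pow_le_pow_right (by norm_num) hrank
    have hpos : 0 < 2 ^ m := by positivity
    have hlt : Nat.card (K ⧸ W) < 2 ^ m := by omega
    have := Nat.mul_lt_mul_of_lt_of_le hlt hcardW hpos
    rw [← hprod, two_mul, pow_add] at this
    exact this.false
  obtain ⟨v, rfl⟩ := W.mkQ_surjective q
  have hvW : ∀ w ∈ W, IsBent m F (w + v) := by
    intro w hw
    by_contra hb
    refine hq ⟨w + v, hb, ?_⟩
    rw [map_add, add_eq_right, Submodule.mkQ_apply, Submodule.Quotient.mk_eq_zero]
    exact hw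
  have hP' : P (W ⊔ Submodule.span (ZMod 2) {v}) := by
    refine ⟨Submodule.mem_sup_left hxyW, fun a ha ha0 => ?_⟩
    obtain ⟨w, hw, z, hz, rfl⟩ := Submodule.mem_sup.mp ha
    obtain ⟨c, rfl⟩ := Submodule.mem_span_singleton.mp hz
    rcases (by decide : ∀ c : ZMod 2, c = 0 ∨ c = 1) c with rfl | rfl
    · rw [zero_smul, add_zero] at ha0 ⊢
      exact hWbent w hw ha0
    · rw [one_smul]
      exact hvW w hw
  have hv : v ∈ W := hW.le_of_ge hP' le_sup_left
    (Submodule.mem_sup_right (Submodule.mem_span_singleton_self v))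
  refine hq ⟨0, not_isBent_zero hm hcard, ?_⟩
  rw [map_zero, eq_comm, Submodule.mkQ_apply, Submodule.Quotient.mk_eq_zero]
  exact hv

/-- The subspace of non-bent components, when there are exactly `2 ^ m` of them. -/
def nonBentSubmodule (hm : 0 < m) (hcard : Fintype.card K = 2 ^ (2 * m))
    (hS : Set.ncard {a : K | ¬ IsBent m F a} = 2 ^ m) : Submodule (ZMod 2) K where
  carrier := {a : K | ¬ IsBent m F a}
  zero_mem' := not_isBent_zero hm hcard
  add_mem' := add_not_isBent hm hcard hS
  smul_mem' c a ha := by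
    rcases (by decide : ∀ c : ZMod 2, c = 0 ∨ c = 1) c with rfl | rfl
    · rw [zero_smul]
      exact not_isBent_zero hm hcard
    · rwa [one_smul]

lemma mem_nonBentSubmodule (hm : 0 < m) (hcard : Fintype.card K = 2 ^ (2 * m))
    (hS : Set.ncard {a : K | ¬ IsBent m F a} = 2 ^ m) (a : K) :
    a ∈ nonBentSubmodule hm hcard hS ↔ ¬ IsBent m F a := Iff.rfl

lemma card_nonBentSubmodule (hm : 0 < m) (hcard : Fintype.card K = 2 ^ (2 * m))
    (hS : Set.ncard {a : K | ¬ IsBent m F a} = 2 ^ m) :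
    Nat.card (nonBentSubmodule hm hcard hS) = 2 ^ m := hS

lemma finrank_nonBentSubmodule (hm : 0 < m) (hcard : Fintype.card K = 2 ^ (2 * m))
    (hS : Set.ncard {a : K | ¬ IsBent m F a} = 2 ^ m) :
    Module.finrank (ZMod 2) (nonBentSubmodule hm hcard hS) = m := by
  classical
  have h := card_nonBentSubmodule hm hcard hS
  rw [Nat.card_eq_fintype_card, Module.card_eq_pow_finrank (K := ZMod 2), ZMod.card] at h
  exact Nat.pow_right_injective le_rfl h

lemma bijective_sq : Function.Bijective fun x : K => x ^ 2 := by
  have h := (FiniteField.frobeniusAlgEquivOfAlgebraic (ZMod 2) K).bijective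
  rw [FiniteField.coe_frobeniusAlgEquivOfAlgebraic] at h
  simpa only [ZMod.card] using h

lemma walsh_sq (hF : ∀ x, F (x ^ 2) = F x ^ 2) (a ω : K) :
    walsh F (a ^ 2) (ω ^ 2) = walsh F a ω := by
  rw [walsh_eq_sum_traceSign, walsh_eq_sum_traceSign,
    ← Function.Bijective.sum_comp (bijective_sq (K := K))]
  refine Finset.sum_congr rfl fun v _ => ?_
  rw [hF, ← mul_pow, ← mul_pow, ← add_sq_eq_sq_add_sq, traceSign_sq]

lemma IsBent.of_sq (hF : ∀ x, F (x ^ 2) = F x ^ 2) {a : K} (ha : IsBent m F (a ^ 2)) :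
    IsBent m F a := fun ω => walsh_sq hF a ω ▸ ha (ω ^ 2)

lemma IsBent.of_mul {c l a : K} (hl : l ≠ 0) (hF : ∀ x, F (l * x) = c * F x)
    (ha : IsBent m F (a * c)) : IsBent m F a := by
  intro ω
  have h : walsh F a ω = walsh F (a * c) (ω * l) := by
    rw [walsh_eq_sum_traceSign, walsh_eq_sum_traceSign,
      ← Equiv.sum_comp (Equiv.mulLeft₀ l hl)]
    refine Finset.sum_congr rfl fun v _ => ?_
    simp only [Equiv.mulLeft₀_apply, hF, mul_assoc]
  rw [h]
  exact ha _

/-- If `F` is invariant under multiplication by the `e`-th roots of unity, then the Walsh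
coefficients at `0` are congruent to `1` modulo `e`. -/
lemma dvd_walsh_sub_one {e : ℕ} (he : e ∣ Fintype.card K - 1) (hF0 : F 0 = 0)
    (hF : ∀ z x : K, z ^ e = 1 → F (x * z) = F x) (a : K) :
    (e : ℤ) ∣ walsh F a 0 - 1 := by
  classical
  have hsum : walsh F a 0 - 1 = ∑ u : Kˣ, traceSign (a * F u) := by
    rw [walsh_zero_right, ← Finset.add_sum_erase _ _ (Finset.mem_univ (0 : K)), hF0]
    have h1 : traceSign (a * 0 : K) = 1 := by simp [traceSign]
    rw [h1, add_sub_cancel_left]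
    refine Finset.sum_bij' (fun x hx => Units.mk0 x (Finset.ne_of_mem_erase hx))
      (fun u _ => (u : K)) ?_ ?_ ?_ ?_ ?_ <;> simp
  let H := (powMonoidHom e : Kˣ →* Kˣ).ker
  have hH : Fintype.card H = e := by
    rw [← Nat.card_eq_fintype_card, IsCyclic.card_powMonoidHom_ker, Nat.card_eq_fintype_card,
      Fintype.card_units]
    exact Nat.gcd_eq_right he
  rw [hsum, ← Finset.sum_fiberwise Finset.univ (QuotientGroup.mk : Kˣ → Kˣ ⧸ H)]
  refine Finset.dvd_sum fun q _ => ?_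
  obtain ⟨g, rfl⟩ := QuotientGroup.mk_surjective q
  have hfiber : ({u : Kˣ | (u : Kˣ ⧸ H) = g} : Finset Kˣ) =
      (Finset.univ : Finset H).map
        ((Function.Embedding.subtype _).trans (mulLeftEmbedding g)) := by
    ext u
    simp only [Finset.mem_filter_univ, eq_comm, QuotientGroup.eq, Finset.mem_map,
      Finset.mem_univ, true_and, Function.Embedding.trans_apply, Function.Embedding.subtype_apply,
      mulLeftEmbedding_apply]
    exact ⟨fun h => ⟨⟨_, h⟩, by simp⟩, by rintro ⟨h, rfl⟩; simp⟩
  have hconst : ∀ h : H, traceSign (a * F ((g * h : Kˣ) : K)) = traceSign (a * F g) := by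
    intro h
    rw [Units.val_mul, hF]
    have h2 := h.2
    rw [MonoidHom.mem_ker, powMonoidHom_apply] at h2
    rw [← Units.val_pow_eq_pow_val, h2, Units.val_one]
  rw [hfiber, Finset.sum_map]
  simp only [Function.Embedding.trans_apply, Function.Embedding.subtype_apply,
    mulLeftEmbedding_apply, hconst, Finset.sum_const, Finset.card_univ, hH, nsmul_eq_mul]
  exact Dvd.intro _ rfl

/-- With exactly `2 ^ m` non-bent components and a nontrivial multiplicative symmetry,
all bent components have Walsh coefficient `2 ^ m` at `0`, and `F` has many zeros. -/
lemma dvd_and_le_card_zeros (hm : 0 < m) (hcard : Fintype.card K = 2 ^ (2 * m))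
    (hS : Set.ncard {a : K | ¬ IsBent m F a} = 2 ^ m)
    {e : ℕ} (he : e ∣ Fintype.card K - 1) (he1 : 1 < e) (hF0 : F 0 = 0) (hF1 : F 1 = 0)
    (hF : ∀ z x : K, z ^ e = 1 → F (x * z) = F x) :
    (e : ℤ) ∣ 2 ^ m - 1 ∧ 2 ^ m ≤ Nat.card {v : K | F v = 0} := by
  classical
  set V := nonBentSubmodule hm hcard hS
  have hVcard : Nat.card V = 2 ^ m := card_nonBentSubmodule hm hcard hS
  have hpos : (1 : ℤ) < 2 ^ m := one_lt_pow₀ (by norm_num) hm.ne'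
  have hdvd := dvd_walsh_sub_one he hF0 hF
  have he3 : ¬ (e : ℤ) ∣ 2 := by
    intro h2
    have h2' : e ∣ 2 := by exact_mod_cast h2
    have : e = 2 := ((Nat.dvd_prime Nat.prime_two).mp h2').resolve_left he1.ne'
    rw [this, hcard] at he
    have : 2 ∣ 2 ^ (2 * m) := dvd_pow_self 2 (by omega)
    have : 0 < 2 ^ (2 * m) := by positivity
    omega
  obtain ⟨ε, hε, hεdvd, hbent⟩ : ∃ ε : ℤ, (ε = 1 ∨ ε = -1) ∧
      (∀ a, IsBent m F a → (e : ℤ) ∣ ε * 2 ^ m - 1) ∧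
      ∀ a, IsBent m F a → walsh F a 0 = ε * 2 ^ m := by
    by_cases h : ∃ a, IsBent m F a ∧ walsh F a 0 = 2 ^ m
    · obtain ⟨a, -, ha⟩ := h
      have hd := ha ▸ hdvd a
      refine ⟨1, Or.inl rfl, fun _ _ => by simpa using hd, fun b hb => ?_⟩
      rcases hb 0 with h0 | h0
      · simpa using h0
      · refine absurd ?_ he3
        have := dvd_add hd (h0 ▸ hdvd b)
        rw [show (2 : ℤ) ^ m - 1 + (-2 ^ m - 1) = -2 by ring, dvd_neg] at this
        exact this
    · push Not at h
      have hb : ∀ a, IsBent m F a → walsh F a 0 = -1 * 2 ^ m := fun a ha => by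
        simpa using (ha 0).resolve_left (h a ha)
      exact ⟨-1, Or.inr rfl, fun a ha => hb a ha ▸ hdvd a, hb⟩
  have hall := sum_walsh_univ F
  have hsub := sum_walsh_submodule F V
  generalize hP : #{v : K | ∀ a ∈ V, Algebra.trace (ZMod 2) K (a * F v) = 0} = P at hsub
  have hP0 : 0 < P := by
    rw [← hP, Finset.card_pos]
    exact ⟨0, by simp [hF0]⟩
  have hPle : P ≤ 2 ^ (2 * m) := by
    rw [← hP, ← hcard]
    exact Finset.card_le_univ _
  have hzero : #{v : K | F v = 0} = Nat.card {v : K | F v = 0} := by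
    simp [Fintype.card_subtype]
  rw [hzero] at hall
  generalize hZ : Nat.card {v : K | F v = 0} = Z at hall
  have hZ2 : 2 ≤ Z := by
    rw [← hZ, ← hzero]
    exact Finset.one_lt_card.mpr ⟨0, by simp [hF0], 1, by simp [hF1], zero_ne_one⟩
  have hVfilter : #{a : K | a ∈ V} = 2 ^ m := by
    rw [← hVcard, Nat.card_eq_fintype_card, Fintype.card_subtype]
  have hnotV : (#{a : K | a ∉ V} : ℤ) = 2 ^ m * 2 ^ m - 2 ^ m := by
    have := Finset.card_filter_add_card_filter_not (s := (Finset.univ : Finset K)) (· ∈ V)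
    rw [hVfilter, Finset.card_univ, hcard] at this
    have h' : ((2 ^ m + #{a : K | a ∉ V} : ℕ) : ℤ) = (2 ^ (2 * m) : ℕ) := by exact_mod_cast this
    push_cast at h'
    rw [two_mul, pow_add] at h'
    linarith
  have hsplit : ∑ a : K, walsh F a 0 =
      ∑ a : V, walsh F (a : K) 0 + (2 ^ m * 2 ^ m - 2 ^ m) * (ε * 2 ^ m) := by
    rw [← Finset.sum_filter_add_sum_filter_not Finset.univ (· ∈ V)]
    congr 1
    · exact Finset.sum_subtype _ (by simp) _
    · rw [← hnotV, ← nsmul_eq_mul, ← Finset.sum_const]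
      refine Finset.sum_congr rfl fun a ha => hbent a ?_
      have : a ∉ V := by simpa using ha
      rwa [mem_nonBentSubmodule, not_not] at this
  rw [hsub, hall, hcard, hVcard, two_mul, pow_add] at hsplit
  rw [two_mul, pow_add] at hPle
  have hPle' : (P : ℤ) ≤ 2 ^ m * 2 ^ m := by exact_mod_cast hPle
  push_cast at hsplit
  obtain ⟨a, ha⟩ : ∃ a, IsBent m F a := by
    have hne : #{a : K | a ∉ V} ≠ 0 := by
      intro h0
      rw [h0] at hnotV
      push_cast at hnotV
      nlinarith
    obtain ⟨a, ha⟩ := Finset.card_ne_zero.mp hne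
    have : a ∉ V := by simpa using ha
    rw [mem_nonBentSubmodule, not_not] at this
    exact ⟨a, this⟩
  have hd := hεdvd a ha
  generalize hM : (2 : ℤ) ^ m = M at *
  have hkey : M * Z = P + (M * M - M) * ε :=
    mul_left_cancel₀ (show M ≠ 0 by positivity) (by linarith)
  have hPZ : (0 : ℤ) < P := by exact_mod_cast hP0
  have hZZ : (2 : ℤ) ≤ Z := by exact_mod_cast hZ2
  rcases hε with rfl | rfl
  · refine ⟨by simpa using hd, ?_⟩
    have hlt : M * (M - 1) < M * Z := by linarith
    have : M - 1 < Z := lt_of_mul_lt_mul_left hlt (by linarith)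
    zify
    rw [hM]
    linarith
  · exfalso
    nlinarith

end BentComponents

/-- A proper subfield of a field of order `q ^ 2` has at most `q` elements. -/
lemma card_subfield_le {K : Type*} [Field K] [Fintype K] {q : ℕ} (hcard : Fintype.card K = q ^ 2)
    {E : Subfield K} (hE : E ≠ ⊤) : Nat.card E ≤ q := by
  classical
  have hpow := Module.card_eq_pow_finrank (K := E) (V := K)
  have hrank : 2 ≤ Module.finrank E K := by
    have hpos : 0 < Module.finrank E K := Module.finrank_pos
    have hne : Module.finrank E K ≠ 1 := by
      intro h1
      rw [h1, pow_one] at hpow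
      refine hE (SetLike.coe_injective ?_)
      rw [Subfield.coe_top]
      refine Set.eq_of_subset_of_card_le (Set.subset_univ _) ?_
      rw [Fintype.card_setUniv, hpow]
      exact le_rfl
    omega
  rw [Nat.card_eq_fintype_card, ← Nat.pow_le_pow_iff_left (two_ne_zero), ← hcard, hpow]
  exact Nat.pow_le_pow_right Fintype.card_pos hrank

section FrobeniusModule

variable {K : Type*} [Field K] [Fintype K] [Algebra (ZMod 2) K]

/-- Every Frobenius-stable subspace is generated by the Frobenius orbit of one element. -/
lemma exists_frobSpan_eq (V : Submodule (ZMod 2) K) (hV : ∀ x ∈ V, x ^ 2 ∈ V) :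
    ∃ γ : K, frobSpan K γ = V := by
  let φ := FiniteField.frobeniusAlgEquivOfAlgebraic (ZMod 2) K
  let T : K →ₗ[ZMod 2] K := φ.toLinearMap
  have hTapply : ∀ x, T x = x ^ 2 := fun x => by
    change φ x = x ^ 2
    rw [FiniteField.coe_frobeniusAlgEquivOfAlgebraic, ZMod.card]
  have hTpow : ∀ (i : ℕ) (x : K), (T ^ i) x = x ^ 2 ^ i := by
    intro i
    induction i with
    | zero => simp
    | succ i ih =>
      intro x
      rw [pow_succ', Module.End.mul_apply, ih, hTapply, ← pow_mul, pow_succ]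
  let θ := IsGalois.normalBasis (ZMod 2) K 1
  have hcyclic : ∀ x : K, ∃ p : Polynomial (ZMod 2), Polynomial.aeval T p θ = x := by
    let R : Submodule (ZMod 2) K := LinearMap.range
      ((LinearMap.applyₗ θ).comp (Polynomial.aeval (R := ZMod 2) T).toLinearMap)
    have htop : R = ⊤ := by
      rw [eq_top_iff, ← (IsGalois.normalBasis (ZMod 2) K).span_eq, Submodule.span_le]
      rintro _ ⟨σ, rfl⟩
      rw [IsGalois.normalBasis_apply]
      obtain ⟨i, rfl⟩ := (FiniteField.bijective_frobeniusAlgEquivOfAlgebraic_pow (ZMod 2) K).2 σ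
      refine ⟨Polynomial.X ^ (i : ℕ), ?_⟩
      simp only [LinearMap.comp_apply, AlgHom.toLinearMap_apply, map_pow, Polynomial.aeval_X,
        LinearMap.applyₗ_apply_apply, hTpow, AlgEquiv.coe_pow]
      rw [FiniteField.coe_frobeniusAlgEquivOfAlgebraic_iterate, ZMod.card]
    intro x
    obtain ⟨p, hp⟩ : x ∈ R := htop ▸ Submodule.mem_top
    exact ⟨p, hp⟩
  have hpowmem : ∀ (i : ℕ), ∀ x ∈ V, (T ^ i) x ∈ V := by
    intro i
    induction i with
    | zero => simp
    | succ i ih =>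
      intro x hx
      rw [pow_succ', Module.End.mul_apply, hTapply]
      exact hV _ (ih x hx)
  have hpoly : ∀ (W : Submodule (ZMod 2) K) (x : K), (∀ i : ℕ, (T ^ i) x ∈ W) →
      ∀ p : Polynomial (ZMod 2), Polynomial.aeval T p x ∈ W := by
    intro W x hx p
    rw [Polynomial.aeval_eq_sum_range, LinearMap.sum_apply]
    exact W.sum_mem fun i _ => W.smul_mem _ (hx i)
  let I : Ideal (Polynomial (ZMod 2)) :=
    { carrier := {p | Polynomial.aeval T p θ ∈ V}
      zero_mem' := by simp
      add_mem' := fun {p q} hp hq => by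
        simpa only [Set.mem_ofPred_eq, map_add, LinearMap.add_apply] using V.add_mem hp hq
      smul_mem' := fun c p hp => by
        simp only [Set.mem_ofPred_eq, smul_eq_mul, map_mul, Module.End.mul_apply]
        exact hpoly V _ (fun i => hpowmem i _ hp) c }
  obtain ⟨g, hg⟩ := (IsPrincipalIdealRing.principal I).principal
  have hgI : g ∈ I := hg ▸ Submodule.mem_span_singleton_self g
  refine ⟨Polynomial.aeval T g θ, le_antisymm ?_ fun x hx => ?_⟩
  · refine Submodule.span_le.mpr ?_
    rintro _ ⟨i, rfl⟩
    simp only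
    rw [← hTpow]
    exact hpowmem i _ hgI
  · obtain ⟨p, rfl⟩ := hcyclic x
    have hp : p ∈ I := hx
    rw [hg] at hp
    obtain ⟨c, rfl⟩ := Submodule.mem_span_singleton.mp hp
    rw [smul_eq_mul, map_mul, Module.End.mul_apply]
    refine hpoly _ _ (fun i => ?_) c
    rw [hTpow]
    exact Submodule.subset_span ⟨i, rfl⟩

/-- A Frobenius-stable subspace of dimension `m` is the subfield of order `2 ^ m`, provided
no element generating `K` has an orbit spanning a subspace of dimension at most `m`. -/
lemma exists_subfield_coe_eq {m : ℕ} (hcard : Fintype.card K = 2 ^ (2 * m))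
    (hell : ∀ γ : K, Subfield.closure {γ} = ⊤ → m < Module.finrank (ZMod 2) (frobSpan K γ))
    (V : Submodule (ZMod 2) K) (hrank : Module.finrank (ZMod 2) V = m)
    (hV : ∀ x ∈ V, x ^ 2 ∈ V) :
    ∃ E : Subfield K, (E : Set K) = V ∧ Nat.card E = 2 ^ m := by
  classical
  obtain ⟨γ, rfl⟩ := exists_frobSpan_eq V hV
  have hE : Subfield.closure {γ} ≠ ⊤ := fun h => (hell γ h).ne' hrank
  have hle : Nat.card (Subfield.closure {γ}) ≤ 2 ^ m :=
    card_subfield_le (by rw [hcard, mul_comm, pow_mul]) hE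
  have hsub : (frobSpan K γ : Set K) ⊆ Subfield.closure {γ} := by
    intro x hx
    rw [SetLike.mem_coe, frobSpan] at hx
    induction hx using Submodule.span_induction with
    | mem x h =>
      obtain ⟨i, rfl⟩ := h
      exact pow_mem (Subfield.subset_closure (Set.mem_singleton γ)) _
    | zero => exact zero_mem _
    | add x y hx hy ihx ihy => exact add_mem ihx ihy
    | smul c x hx ih =>
      rcases (by decide : ∀ c : ZMod 2, c = 0 ∨ c = 1) c with rfl | rfl
      · rw [zero_smul]
        exact zero_mem _
      · rw [one_smul]
        exact ih
  have hcardV : Nat.card (frobSpan K γ) = 2 ^ m := by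
    rw [Nat.card_eq_fintype_card, Module.card_eq_pow_finrank (K := ZMod 2), ZMod.card, hrank]
  have heq : (frobSpan K γ : Set K) = Subfield.closure {γ} :=
    Set.eq_of_subset_of_ncard_le hsub (by
      change Nat.card (Subfield.closure {γ}) ≤ Nat.card (frobSpan K γ)
      rwa [hcardV])
  refine ⟨_, heq.symm, le_antisymm hle ?_⟩
  rw [← hcardV]
  exact Set.ncard_le_ncard hsub

end FrobeniusModule

/-- A divisor of `M * (M + 2)`, `M` odd, of size at least `M`, is `M` itself as soon as it
divides `d * M` and every common prime factor with `d` divides `M`. -/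
lemma eq_of_dvd_mul_add_two {D M d : ℕ} (hM : Odd M) (hD : D ∣ M * (M + 2)) (hle : M ≤ D)
    (hd : D ∣ d * M) (hprime : ∀ p : ℕ, p.Prime → p ∣ D → p ∣ d → p ∣ M) : D = M := by
  have hcop : Nat.Coprime D (M + 2) := by
    refine Nat.Coprime.symm (Nat.coprime_of_dvd fun p hp hp2 hpD => ?_)
    have hpM : p ∣ M := (hp.dvd_mul.mp (hpD.trans hd)).elim (hprime p hp hpD) id
    have hp2' : p ∣ 2 := (Nat.dvd_add_right hpM).mp hp2
    rw [(Nat.prime_dvd_prime_iff_eq hp Nat.prime_two).mp hp2'] at hpM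
    exact (Nat.not_even_iff_odd.mpr hM) (even_iff_two_dvd.mpr hpM)
  exact le_antisymm (Nat.le_of_dvd hM.pos (hcop.dvd_of_dvd_mul_right hD)) hle

/-- Let `n = 2m`, `N = 2^n − 1`, `F(x) = x^{d₁} + x^{d₂}` with `wt₂(d₁) = wt₂(d₂) = 2` and
`gcd(d₁, d₂, N) > 1`.  If `ℓ(n) > m` and `#S_F = 2^m`, then `d₂ − d₁ ≡ 0 (mod 2^m − 1)`. -/
theorem stmt12 (m n : ℕ) (hm : 0 < m) (hn : n = 2 * m) (N : ℕ) (hN : N = 2 ^ n - 1)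
    (K : Type*) [Field K] [Fintype K] [Algebra (ZMod 2) K]
    (hcard : Fintype.card K = 2 ^ n)
    (d₁ d₂ : ℕ) (hd₁ : 1 ≤ d₁) (hd₁' : d₁ ≤ N - 1) (hd₂ : 1 ≤ d₂) (hd₂' : d₂ ≤ N - 1)
    (hw₁ : wt2 N (d₁ : ℤ) = 2) (hw₂ : wt2 N (d₂ : ℤ) = 2)
    (hgcd : 1 < Nat.gcd d₁ (Nat.gcd d₂ N))
    (F : K → K) (hF : ∀ x, F x = x ^ d₁ + x ^ d₂)
    (hell : ∀ γ : K, Subfield.closure {γ} = ⊤ →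
      m < Module.finrank (ZMod 2) (frobSpan K γ))
    (hSF : Set.ncard {a : K | ¬ IsBent m F a} = 2 ^ m) :
    ((2 : ℤ) ^ m - 1) ∣ ((d₂ : ℤ) - (d₁ : ℤ)) := by
  subst hn
  classical
  have hone : 1 ≤ 2 ^ m := Nat.one_le_two_pow
  have hd₁0 : d₁ ≠ 0 := by omega
  have hd₂0 : d₂ ≠ 0 := by omega
  set e := Nat.gcd d₁ (Nat.gcd d₂ N)
  have hed₁ : e ∣ d₁ := Nat.gcd_dvd_left _ _
  have hed₂ : e ∣ d₂ := (Nat.gcd_dvd_right _ _).trans (Nat.gcd_dvd_left _ _)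
  have heN : e ∣ Fintype.card K - 1 := by
    rw [hcard, ← hN]
    exact (Nat.gcd_dvd_right _ _).trans (Nat.gcd_dvd_right _ _)
  have hF0 : F 0 = 0 := by simp [hF, hd₁0, hd₂0]
  have hF1 : F 1 = 0 := by simp only [hF, one_pow, add_self_eq_zero_of_algebra_two]
  have hFroot : ∀ z x : K, z ^ e = 1 → F (x * z) = F x := by
    intro z x hz
    have h₁ : z ^ d₁ = 1 := orderOf_dvd_iff_pow_eq_one.mp
      ((orderOf_dvd_of_pow_eq_one hz).trans hed₁)
    have h₂ : z ^ d₂ = 1 := orderOf_dvd_iff_pow_eq_one.mp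
      ((orderOf_dvd_of_pow_eq_one hz).trans hed₂)
    simp only [hF, mul_pow, h₁, h₂, mul_one]
  have hFsq : ∀ x, F (x ^ 2) = F x ^ 2 := fun x => by
    rw [hF, hF, add_sq_eq_sq_add_sq, pow_right_comm x 2 d₁, pow_right_comm x 2 d₂]
  obtain ⟨heM, hzeros⟩ := dvd_and_le_card_zeros hm hcard hSF heN hgcd hF0 hF1 hFroot
  obtain ⟨E, hEV, hEcard⟩ := exists_subfield_coe_eq hcard hell (nonBentSubmodule hm hcard hSF)
    (finrank_nonBentSubmodule hm hcard hSF) fun x hx hb => hx (IsBent.of_sq hFsq hb)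
  have hmemE : ∀ a : K, a ∈ E ↔ ¬ IsBent m F a := fun a => by
    rw [← SetLike.mem_coe, hEV]
    exact mem_nonBentSubmodule hm hcard hSF a
  -- The nonzero zeros of `F` form a cyclic group.
  let H : Subgroup Kˣ :=
    { carrier := {u | u ^ d₁ = u ^ d₂}
      one_mem' := by simp
      mul_mem' := fun {u v} hu hv => by
        rw [Set.mem_ofPred_eq] at hu hv ⊢
        rw [mul_pow, mul_pow, hu, hv]
      inv_mem' := fun {u} hu => by
        rw [Set.mem_ofPred_eq] at hu ⊢
        rw [inv_pow, inv_pow, hu] }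
  have hmemH : ∀ u : Kˣ, u ∈ H ↔ u ^ d₁ = u ^ d₂ := fun u => Iff.rfl
  have hFzero : ∀ u : Kˣ, F u = 0 ↔ u ∈ H := fun u => by
    rw [hF, hmemH, Units.ext_iff, Units.val_pow_eq_pow_val, Units.val_pow_eq_pow_val]
    constructor
    · intro h
      rw [← add_left_inj ((u : K) ^ d₂), h, add_self_eq_zero_of_algebra_two]
    · intro h
      rw [h, add_self_eq_zero_of_algebra_two]
  have hHcard : 2 ^ m ≤ Nat.card H + 1 := by
    have hset : {v : K | F v = 0} = insert 0 (Units.val '' (H : Set Kˣ)) := by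
      ext v
      rw [Set.mem_ofPred_eq, Set.mem_insert_iff]
      constructor
      · intro hv
        by_cases h0 : v = 0
        · exact Or.inl h0
        · exact Or.inr ⟨Units.mk0 v h0, (hFzero _).mp hv, rfl⟩
      · rintro (rfl | ⟨u, hu, rfl⟩)
        · exact hF0
        · exact (hFzero u).mpr hu
    rw [Nat.card_coe_set_eq, hset] at hzeros
    refine hzeros.trans ((Set.ncard_insert_le _ _).trans ?_)
    rw [Set.ncard_image_of_injective _ Units.val_injective]
    exact le_rfl
  obtain ⟨u, hu⟩ := IsCyclic.exists_generator (α := H)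
  have horder : orderOf (u : Kˣ) = Nat.card H := by
    rw [Subgroup.orderOf_coe, orderOf_eq_card_of_forall_mem_zpowers hu]
  have huH := (hmemH u).mp u.2
  have hdiff : (Nat.card H : ℤ) ∣ (d₂ : ℤ) - d₁ := by
    rw [← horder, orderOf_dvd_iff_zpow_eq_one, zpow_sub, zpow_natCast, zpow_natCast, huH,
      mul_inv_cancel]
  have hpowM : (u : Kˣ) ^ (d₁ * (2 ^ m - 1)) = 1 := by
    have hFu : ∀ x, F (((u : Kˣ) : K) * x) = ((u : Kˣ) : K) ^ d₁ * F x := fun x => by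
      have huH' := congrArg Units.val huH
      rw [Units.val_pow_eq_pow_val, Units.val_pow_eq_pow_val] at huH'
      rw [hF, hF, mul_pow, mul_pow, mul_add, ← huH']
    have hmem : ((u : Kˣ) : K) ^ d₁ ∈ E := by
      rw [hmemE]
      intro hb
      refine (hmemE 1).mp (one_mem E) (IsBent.of_mul (u : Kˣ).ne_zero hFu ?_)
      rwa [one_mul]
    have hfix := FiniteField.pow_card_sub_one_eq_one (⟨_, hmem⟩ : E) fun h0 =>
      (u : Kˣ).ne_zero (eq_zero_of_pow_eq_zero (congrArg Subtype.val h0))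
    rw [← Nat.card_eq_fintype_card, hEcard] at hfix
    have hfix' := congrArg Subtype.val hfix
    rw [pow_mul, Units.ext_iff]
    simpa using hfix'
  have hMcast : ((2 ^ m - 1 : ℕ) : ℤ) = 2 ^ m - 1 := by
    rw [Nat.cast_sub hone]
    norm_num
  have hHN : Nat.card H ∣ N := by
    rw [hN, ← hcard, ← Fintype.card_units, ← Nat.card_eq_fintype_card]
    exact Subgroup.card_subgroup_dvd_card H
  have hDM : Nat.card H = 2 ^ m - 1 := by
    refine eq_of_dvd_mul_add_two (d := d₁) ?_ ?_ (by omega) ?_ ?_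
    · exact Nat.Even.sub_odd hone ((Nat.even_pow.mpr ⟨even_two, hm.ne'⟩)) odd_one
    · have hfactor : (2 ^ m - 1) * (2 ^ m - 1 + 2) = 2 ^ (2 * m) - 1 := by
        rw [two_mul, pow_add]
        obtain ⟨k, hk⟩ := Nat.exists_eq_add_of_le hone
        rw [hk, Nat.add_sub_cancel_left]
        have : (1 + k) * (1 + k) = k * (k + 2) + 1 := by ring
        omega
      rwa [hfactor, ← hN]
    · rw [← horder]
      exact orderOf_dvd_of_pow_eq_one hpowM
    · intro p hp hpD hpd₁
      have hpd₂ : p ∣ d₂ := by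
        have h := (Int.natCast_dvd_natCast.mpr hpD).trans hdiff
        exact Int.natCast_dvd_natCast.mp
          ((dvd_sub_left (Int.natCast_dvd_natCast.mpr hpd₁)).mp h)
      have hpe : p ∣ e := Nat.dvd_gcd hpd₁ (Nat.dvd_gcd hpd₂ (hpD.trans hHN))
      rw [← hMcast, Int.natCast_dvd_natCast] at heM
      exact hpe.trans heM
  rwa [hDM, hMcast] at hdiff
end

section
/- Let F : F_{2^n} → F_{2^n} be any non-injective function, and set Δ = {x + y : x, y ∈ F_{2^n}, x ≠ y, F(x) = F(y)}. Then the differential uniformity of F satisfies δ_F ≥ ⌈ (2^n / #Δ) · (2^n / #Im(F) − 1) ⌉. -/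
open Finset

/-- The differential uniformity `δ_F = max_{a ≠ 0, b} #{x : F(x+a) + F(x) = b}`. -/
def diffUnif {K : Type*} [Field K] [Fintype K] [DecidableEq K] (F : K → K) : ℕ :=
  (Finset.univ.filter fun a : K => a ≠ 0).sup fun a =>
    Finset.univ.sup fun b : K =>
      (Finset.univ.filter fun x : K => F (x + a) + F x = b).card

/-- By Cauchy–Schwarz, the collision pairs of `f` number at least `(card α)² / #(image of f)`. -/
lemma sq_card_le_card_image_mul_card_collisions {α β : Type*} [Fintype α] [DecidableEq β]
    (f : α → β) :
    Fintype.card α ^ 2 ≤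
      (univ.image f).card * (univ.filter fun p : α × α => f p.1 = f p.2).card := by
  have h_univ : Fintype.card α = ∑ b ∈ univ.image f, (univ.filter fun x => f x = b).card :=
    card_eq_sum_card_fiberwise fun x _ => mem_image_of_mem f (mem_univ x)
  have h_pairs : (univ.filter fun p : α × α => f p.1 = f p.2).card =
      ∑ b ∈ univ.image f, (univ.filter fun x => f x = b).card ^ 2 := by
    rw [card_eq_sum_card_fiberwise (f := fun p : α × α => f p.1) (t := univ.image f)
      fun p _ => mem_image_of_mem f (mem_univ p.1)]
    refine sum_congr rfl fun b _ => ?_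
    rw [sq, ← card_product]
    congr 1
    ext p
    simp only [mem_filter, mem_univ, true_and, mem_product]
    grind
  rw [h_univ, h_pairs]
  exact sq_sum_le_card_mul_sum_sq

lemma card_filter_le_diffUnif {K : Type*} [Field K] [Fintype K] [DecidableEq K] (F : K → K)
    {a : K} (ha : a ≠ 0) (b : K) :
    (univ.filter fun x : K => F (x + a) + F x = b).card ≤ diffUnif F :=
  (le_sup (f := fun b : K => (univ.filter fun x : K => F (x + a) + F x = b).card)
    (mem_univ b)).trans
    (le_sup (f := fun a : K => univ.sup fun b : K =>
      (univ.filter fun x : K => F (x + a) + F x = b).card) (by simp [ha]))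

/-- In characteristic two, a collision `F x = F y` with `x + y = a` is a solution of
`F (x + a) + F x = 0`. -/
lemma card_collisions_le {K : Type*} [Field K] [CharP K 2] [Fintype K] [DecidableEq K]
    (F : K → K) (D : Finset K) (hD : ∀ x y : K, x ≠ y → F x = F y → x + y ∈ D)
    (hD0 : (0 : K) ∉ D) :
    (univ.filter fun p : K × K => F p.1 = F p.2).card ≤
      Fintype.card K + D.card * diffUnif F := by
  have h_fiber (a : K) :
      ((univ.filter fun p : K × K => F p.1 = F p.2).filter fun p => p.1 + p.2 = a).card ≤
        (univ.filter fun x : K => F (x + a) + F x = 0).card := by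
    refine card_le_card_of_injOn Prod.fst ?_ ?_
    · rintro ⟨x, y⟩ h
      simp only [coe_filter, mem_filter, mem_univ, true_and, Set.mem_ofPred_eq] at h ⊢
      obtain ⟨h, rfl⟩ := h
      rw [← add_assoc, CharTwo.add_self_eq_zero, zero_add, h, CharTwo.add_self_eq_zero]
    · rintro ⟨x, y⟩ h ⟨x', y'⟩ h' hx
      simp only [coe_filter, mem_filter, mem_univ, true_and, Set.mem_ofPred_eq] at h h' hx
      subst hx
      rw [add_left_cancel (h.2.trans h'.2.symm)]
  rw [card_eq_sum_card_fiberwise (f := fun p : K × K => p.1 + p.2) (t := insert 0 D),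
    sum_insert hD0]
  · refine add_le_add ((h_fiber 0).trans (card_le_univ _)) ?_
    rw [← smul_eq_mul]
    exact sum_le_card_nsmul _ _ _ fun a ha =>
      (h_fiber a).trans (card_filter_le_diffUnif F (ne_of_mem_of_not_mem ha hD0) 0)
  · rintro ⟨x, y⟩ h
    simp only [coe_filter, mem_univ, true_and, Set.mem_ofPred_eq] at h
    rcases eq_or_ne x y with rfl | hxy
    · simp [CharTwo.add_self_eq_zero]
    · exact mem_coe.2 (mem_insert_of_mem (hD x y hxy h))

/-- For a non-injective `F : F_{2^n} → F_{2^n}` with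
`Δ = {x + y : x ≠ y, F(x) = F(y)}`, the differential uniformity satisfies
`δ_F ≥ ⌈(2^n/#Δ)·(2^n/#Im(F) − 1)⌉`. -/
theorem stmt16 (n : ℕ) (hn : 0 < n)
    (K : Type*) [Field K] [Fintype K] [DecidableEq K]
    (hcard : Fintype.card K = 2 ^ n)
    (F : K → K) (hinj : ¬ Function.Injective F) :
    ⌈((2 : ℚ) ^ n / (Set.ncard {d : K | ∃ x y : K, x ≠ y ∧ F x = F y ∧ d = x + y} : ℚ)) *
        ((2 : ℚ) ^ n / (Set.ncard (Set.range F) : ℚ) - 1)⌉ ≤ (diffUnif F : ℤ) := by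
  classical
  have h_two : (2 : K) = 0 := by
    have h : ((Fintype.card K : ℕ) : K) = 0 := Nat.cast_card_eq_zero K
    rw [hcard, Nat.cast_pow] at h
    exact_mod_cast eq_zero_of_pow_eq_zero h
  have : CharP K 2 := CharTwo.of_one_ne_zero_of_two_eq_zero one_ne_zero h_two
  set Δ : Set K := {d : K | ∃ x y : K, x ≠ y ∧ F x = F y ∧ d = x + y}
  have h_zero : (0 : K) ∉ Δ.toFinset := by
    rw [Set.mem_toFinset]
    rintro ⟨x, y, hxy, -, h⟩
    exact hxy (CharTwo.add_eq_zero.1 h.symm)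
  have h_upper := card_collisions_le F Δ.toFinset
    (fun x y hxy h => Set.mem_toFinset.2 ⟨x, y, hxy, h, rfl⟩) h_zero
  have h_lower := sq_card_le_card_image_mul_card_collisions F
  have h_range : (Set.range F).ncard = (univ.image F).card := by
    rw [← Set.ncard_coe_finset, coe_image, coe_univ, Set.image_univ]
  have hΔ_pos : 0 < Δ.toFinset.card := by
    obtain ⟨x, y, h, hxy⟩ := Function.not_injective_iff.1 hinj
    exact card_pos.2 ⟨x + y, Set.mem_toFinset.2 ⟨x, y, hxy, h, rfl⟩⟩
  have h_image_pos : 0 < (univ.image F).card := card_pos.2 (univ_nonempty.image F)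
  rw [h_range, Set.ncard_eq_toFinset_card', Int.ceil_le, Int.cast_natCast, div_mul_eq_mul_div,
    div_le_iff₀ (by exact_mod_cast hΔ_pos), div_sub_one (by positivity), mul_div_assoc',
    div_le_iff₀ (by exact_mod_cast h_image_pos)]
  have h_main := h_lower.trans (Nat.mul_le_mul_left _ h_upper)
  rw [hcard] at h_main
  have h_cast : ((2 : ℚ) ^ n) ^ 2 ≤ ((univ.image F).card : ℚ) *
      (2 ^ n + Δ.toFinset.card * diffUnif F) := by exact_mod_cast h_main
  linarith
end
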